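/- arXiv:1401.0025 — 12 statements merged into one kernel-verified Lean document; each statement's English description precedes it below -/
import Mathlib

section
/- Let f : ℂ → ℂ be twice differentiable. Define φ : ℂ⁴ → ℂ by φ(w, z, w̃, z̃) = exp(w − w̃(z − z̃) − (2/3)w̃³) · f(z̃ − z − w̃²). Then φ satisfies the complexified wave equation ∂²φ/∂z∂z̃ − ∂²φ/∂w∂w̃ = 0 at every point of ℂ⁴ if and only if f satisfies the Airy equation f''(t) + t·f(t) = 0 for all t ∈ ℂ. -/
/-- The mixed derivative in `z` and `zt` of `exp (w - wt (z - zt) - (2/3) wt³) * f (zt - z - wt²)`. -/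
theorem deriv_deriv_exp_mul_comp_z_zt {f : ℂ → ℂ} (hf : Differentiable ℂ f)
    (hf' : Differentiable ℂ (deriv f)) (w z wt zt : ℂ) :
    deriv (fun z' => deriv (fun zt' =>
        Complex.exp (w - wt * (z' - zt') - (2/3) * wt ^ 3) * f (zt' - z' - wt ^ 2)) zt) z
      = Complex.exp (w - wt * (z - zt) - (2/3) * wt ^ 3) *
        (-(wt ^ 2 * f (zt - z - wt ^ 2)) - 2 * wt * deriv f (zt - z - wt ^ 2)
          - deriv (deriv f) (zt - z - wt ^ 2)) := by
  have inner : ∀ z' : ℂ, deriv (fun zt' =>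
        Complex.exp (w - wt * (z' - zt') - (2/3) * wt ^ 3) * f (zt' - z' - wt ^ 2)) zt
      = Complex.exp (w - wt * (z' - zt) - (2/3) * wt ^ 3) *
        (wt * f (zt - z' - wt ^ 2) + deriv f (zt - z' - wt ^ 2)) := by
    intro z'
    have hE := (((((hasDerivAt_id' zt).const_sub z').const_mul wt).const_sub w).sub_const
      ((2/3) * wt ^ 3)).cexp
    have hs := ((hasDerivAt_id' zt).sub_const z').sub_const (wt ^ 2)
    have hF := (hf (zt - z' - wt ^ 2)).hasDerivAt.comp zt hs
    refine (hE.mul hF).deriv.trans ?_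
    simp only [Function.comp_apply]
    ring
  simp only [inner]
  have hE := (((((hasDerivAt_id' z).sub_const zt).const_mul wt).const_sub w).sub_const
    ((2/3) * wt ^ 3)).cexp
  have hs := ((hasDerivAt_id' z).const_sub zt).sub_const (wt ^ 2)
  have hF := (hf (zt - z - wt ^ 2)).hasDerivAt.comp z hs
  have hG := (hf' (zt - z - wt ^ 2)).hasDerivAt.comp z hs
  refine (hE.mul ((hF.const_mul wt).add hG)).deriv.trans ?_
  simp only [Function.comp_apply, Pi.add_apply]
  ring

/-- The mixed derivative in `w` and `wt` of `exp (w - wt (z - zt) - (2/3) wt³) * f (zt - z - wt²)`. -/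
theorem deriv_deriv_exp_mul_comp_w_wt {f : ℂ → ℂ} (hf : Differentiable ℂ f) (w z wt zt : ℂ) :
    deriv (fun w' => deriv (fun wt' =>
        Complex.exp (w' - wt' * (z - zt) - (2/3) * wt' ^ 3) * f (zt - z - wt' ^ 2)) wt) w
      = Complex.exp (w - wt * (z - zt) - (2/3) * wt ^ 3) *
        ((zt - z - 2 * wt ^ 2) * f (zt - z - wt ^ 2) - 2 * wt * deriv f (zt - z - wt ^ 2)) := by
  have inner : ∀ w' : ℂ, deriv (fun wt' =>
        Complex.exp (w' - wt' * (z - zt) - (2/3) * wt' ^ 3) * f (zt - z - wt' ^ 2)) wt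
      = Complex.exp (w' - wt * (z - zt) - (2/3) * wt ^ 3) *
        ((zt - z - 2 * wt ^ 2) * f (zt - z - wt ^ 2)
          - 2 * wt * deriv f (zt - z - wt ^ 2)) := by
    intro w'
    have hE := ((((hasDerivAt_id' wt).mul_const (z - zt)).const_sub w').sub
      ((hasDerivAt_pow 3 wt).const_mul (2/3))).cexp
    have hs := (hasDerivAt_pow 2 wt).const_sub (zt - z)
    have hF := (hf (zt - z - wt ^ 2)).hasDerivAt.comp wt hs
    refine (hE.mul hF).deriv.trans ?_
    simp only [Function.comp_apply, Pi.sub_apply]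
    push_cast
    ring
  simp only [inner]
  have hE := (((hasDerivAt_id' w).sub_const (wt * (z - zt))).sub_const ((2/3) * wt ^ 3)).cexp
  refine (hE.mul_const _).deriv.trans ?_
  ring


/-- Let `f : ℂ → ℂ` be twice differentiable and let
`φ (w, z, wt, zt) = exp (w - wt * (z - zt) - (2/3) wt³) * f (zt - z - wt²)`
(where `wt = w̃`, `zt = z̃`).  Then `φ` satisfies the complexified wave equation
`∂²φ/∂z∂z̃ - ∂²φ/∂w∂w̃ = 0` everywhere on `ℂ⁴` iff `f` satisfies the Airy
equation `f'' t + t * f t = 0` for all `t : ℂ`. -/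
theorem stmt0 (f : ℂ → ℂ) (hf : Differentiable ℂ f) (hf' : Differentiable ℂ (deriv f))
    (φ : ℂ → ℂ → ℂ → ℂ → ℂ)
    (hφ : ∀ w z wt zt : ℂ,
      φ w z wt zt = Complex.exp (w - wt * (z - zt) - (2/3) * wt ^ 3) * f (zt - z - wt ^ 2)) :
    (∀ w z wt zt : ℂ,
        deriv (fun z' => deriv (fun zt' => φ w z' wt zt') zt) z
          - deriv (fun w' => deriv (fun wt' => φ w' z wt' zt) wt) w = 0)
      ↔ (∀ t : ℂ, deriv (deriv f) t + t * f t = 0) := by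
  have key : ∀ w z wt zt : ℂ,
      deriv (fun z' => deriv (fun zt' => φ w z' wt zt') zt) z
          - deriv (fun w' => deriv (fun wt' => φ w' z wt' zt) wt) w
        = -(Complex.exp (w - wt * (z - zt) - (2/3) * wt ^ 3) *
            (deriv (deriv f) (zt - z - wt ^ 2) + (zt - z - wt ^ 2) * f (zt - z - wt ^ 2))) := by
    intro w z wt zt
    simp only [hφ]
    rw [deriv_deriv_exp_mul_comp_z_zt hf hf', deriv_deriv_exp_mul_comp_w_wt hf]
    ring
  constructor
  · intro h t
    have h0 := h 0 0 0 t
    rw [key, neg_eq_zero] at h0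
    simpa using h0
  · intro h w z wt zt
    rw [key, h, mul_zero, neg_zero]
end

section
/- Let f : ℝ → ℝ be twice differentiable. Define φ : ℝ⁴ → ℝ by φ(w, z, w̃, z̃) = exp(w − w̃(z − z̃) − (2/3)w̃³) · f(z̃ − z − w̃²). Then φ satisfies the ultra-hyperbolic wave equation ∂²φ/∂z∂z̃ − ∂²φ/∂w∂w̃ = 0 at every point of ℝ⁴ if and only if f satisfies the Airy equation f''(t) + t·f(t) = 0 for all t ∈ ℝ. -/
/-- Let `f : ℝ → ℝ` be twice differentiable and let
`φ (w, z, wt, zt) = exp (w - wt * (z - zt) - (2/3) wt³) * f (zt - z - wt²)`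
(where `wt = w̃`, `zt = z̃`).  Then `φ` satisfies the ultra-hyperbolic wave
equation `∂²φ/∂z∂z̃ - ∂²φ/∂w∂w̃ = 0` everywhere on `ℝ⁴` iff `f` satisfies the
Airy equation `f'' t + t * f t = 0` for all `t : ℝ`. -/
theorem stmt1 (f : ℝ → ℝ) (hf : Differentiable ℝ f) (hf' : Differentiable ℝ (deriv f))
    (φ : ℝ → ℝ → ℝ → ℝ → ℝ)
    (hφ : ∀ w z wt zt : ℝ,
      φ w z wt zt = Real.exp (w - wt * (z - zt) - (2/3) * wt ^ 3) * f (zt - z - wt ^ 2)) :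
    (∀ w z wt zt : ℝ,
        deriv (fun z' => deriv (fun zt' => φ w z' wt zt') zt) z
          - deriv (fun w' => deriv (fun wt' => φ w' z wt' zt) wt) w = 0)
      ↔ (∀ t : ℝ, deriv (deriv f) t + t * f t = 0) := by
  have wave (w z wt zt : ℝ) :
      deriv (fun z' => deriv (fun zt' => φ w z' wt zt') zt) z
          - deriv (fun w' => deriv (fun wt' => φ w' z wt' zt) wt) w
        = -(Real.exp (w - wt * (z - zt) - (2/3) * wt ^ 3)
          * (deriv (deriv f) (zt - z - wt ^ 2) + (zt - z - wt ^ 2) * f (zt - z - wt ^ 2))) := by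
    have deriv_zt (z' : ℝ) : deriv (fun zt' => φ w z' wt zt') zt
        = Real.exp (w - wt * (z' - zt) - (2/3) * wt ^ 3)
          * (wt * f (zt - z' - wt ^ 2) + deriv f (zt - z' - wt ^ 2)) := by
      simp only [hφ]
      have hS : HasDerivAt (fun x => w - wt * (z' - x) - (2/3) * wt ^ 3) wt zt := by
        simpa using ((((hasDerivAt_id' zt).const_sub z').const_mul wt).const_sub w).sub_const
          ((2/3) * wt ^ 3)
      have hu : HasDerivAt (fun x => x - z' - wt ^ 2) 1 zt :=
        ((hasDerivAt_id' zt).sub_const z').sub_const (wt ^ 2)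
      have h := hS.exp.fun_mul ((hf _).hasDerivAt.comp zt hu)
      refine h.deriv.trans ?_
      simp only [Function.comp_apply]
      ring
    have deriv_wt (w' : ℝ) : deriv (fun wt' => φ w' z wt' zt) wt
        = Real.exp (w' - wt * (z - zt) - (2/3) * wt ^ 3)
          * ((zt - z - 2 * wt ^ 2) * f (zt - z - wt ^ 2)
            - 2 * wt * deriv f (zt - z - wt ^ 2)) := by
      simp only [hφ]
      have hS : HasDerivAt (fun x => w' - x * (z - zt) - (2/3) * x ^ 3)
          (zt - z - 2 * wt ^ 2) wt := by
        refine ((((hasDerivAt_id' wt).mul_const (z - zt)).const_sub w').fun_sub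
          ((hasDerivAt_pow 3 wt).const_mul (2/3))).congr_deriv ?_
        push_cast
        ring
      have hu : HasDerivAt (fun x => zt - z - x ^ 2) (-(2 * wt)) wt := by
        simpa using (hasDerivAt_pow 2 wt).const_sub (zt - z)
      have h := hS.exp.fun_mul ((hf _).hasDerivAt.comp wt hu)
      refine h.deriv.trans ?_
      simp only [Function.comp_apply]
      ring
    have deriv_z_zt : HasDerivAt (fun z' => Real.exp (w - wt * (z' - zt) - (2/3) * wt ^ 3)
          * (wt * f (zt - z' - wt ^ 2) + deriv f (zt - z' - wt ^ 2)))
        (Real.exp (w - wt * (z - zt) - (2/3) * wt ^ 3)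
          * (-wt ^ 2 * f (zt - z - wt ^ 2) - 2 * wt * deriv f (zt - z - wt ^ 2)
            - deriv (deriv f) (zt - z - wt ^ 2))) z := by
      have hS : HasDerivAt (fun x => w - wt * (x - zt) - (2/3) * wt ^ 3) (-wt) z := by
        simpa using ((((hasDerivAt_id' z).sub_const zt).const_mul wt).const_sub w).sub_const
          ((2/3) * wt ^ 3)
      have hu : HasDerivAt (fun x => zt - x - wt ^ 2) (-1) z :=
        ((hasDerivAt_id' z).const_sub zt).sub_const (wt ^ 2)
      have h := hS.exp.fun_mul ((((hf _).hasDerivAt.comp z hu).const_mul wt).fun_add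
        ((hf' _).hasDerivAt.comp z hu))
      refine h.congr_deriv ?_
      simp only [Function.comp_apply]
      ring
    have deriv_w_wt : HasDerivAt (fun w' => Real.exp (w' - wt * (z - zt) - (2/3) * wt ^ 3)
          * ((zt - z - 2 * wt ^ 2) * f (zt - z - wt ^ 2)
            - 2 * wt * deriv f (zt - z - wt ^ 2)))
        (Real.exp (w - wt * (z - zt) - (2/3) * wt ^ 3)
          * ((zt - z - 2 * wt ^ 2) * f (zt - z - wt ^ 2)
            - 2 * wt * deriv f (zt - z - wt ^ 2))) w := by
      have h := (((hasDerivAt_id' w).sub_const (wt * (z - zt))).sub_const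
        ((2/3) * wt ^ 3)).exp.mul_const ((zt - z - 2 * wt ^ 2) * f (zt - z - wt ^ 2)
            - 2 * wt * deriv f (zt - z - wt ^ 2))
      simpa using h
    simp only [deriv_zt, deriv_wt]
    rw [deriv_z_zt.deriv, deriv_w_wt.deriv]
    ring
  simp only [wave, neg_eq_zero, mul_eq_zero, Real.exp_ne_zero, false_or]
  exact ⟨fun h t => by simpa using h 0 0 0 t, fun h _ z wt zt => h (zt - z - wt ^ 2)⟩
end

section
/- Equip ℂ³ with the bilinear bracket [(a₁,a₂,a₃),(b₁,b₂,b₃)] = (a₁b₂ − a₂b₁, 0, 0) (the Bianchi II Lie algebra in the basis L₁, L₂, L₃, with [L₁,L₂] = L₁, [L₁,L₃] = 0, [L₂,L₃] = 0). Fix constants c₁, c₂ ∈ ℂ and let F : ℂ → ℂ be three times differentiable. Define P, Q, R : ℂ → ℂ³ by P(t) = (F(t)/2, 1, 0), Q(t) = ((c₁² + t)F(t)/2 + c₁F'(t) + F''(t), c₁² + t, c₂), R(t) = ((c₁F(t) + F'(t))/2, c₁, 1). Then the reduced anti-self-duality system Q' = [Q,R] + P, R' = (1/2)[Q,P], P'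 = [R,P] holds for all t ∈ ℂ if and only if f := F' satisfies the Airy equation f''(t) + t·f(t) = 0 for all t ∈ ℂ. -/
/-- The Bianchi II Lie bracket on `ℂ³` in the basis `L₁, L₂, L₃` with
`[L₁,L₂] = L₁`, `[L₁,L₃] = 0`, `[L₂,L₃] = 0`:
`[(a₁,a₂,a₃),(b₁,b₂,b₃)] = (a₁ b₂ - a₂ b₁, 0, 0)`. -/
def bianchiIIBracket (a b : ℂ × ℂ × ℂ) : ℂ × ℂ × ℂ :=
  (a.1 * b.2.1 - a.2.1 * b.1, 0, 0)

/-- With `c₁, c₂ : ℂ` constants, `F : ℂ → ℂ` three times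
differentiable, and `P, Q, R : ℂ → ℂ³` given by
`P t = (F t / 2, 1, 0)`,
`Q t = ((c₁² + t) F t / 2 + c₁ F' t + F'' t, c₁² + t, c₂)`,
`R t = ((c₁ F t + F' t)/2, c₁, 1)`,
the reduced anti-self-duality system `Q' = [Q,R] + P`, `R' = ½[Q,P]`,
`P' = [R,P]` holds for all `t` iff `f := F'` satisfies the Airy equation
`f'' t + t * f t = 0` for all `t`. -/
theorem stmt2 (c₁ c₂ : ℂ) (F : ℂ → ℂ)
    (hF : Differentiable ℂ F) (hF' : Differentiable ℂ (deriv F))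
    (hF'' : Differentiable ℂ (deriv (deriv F)))
    (P Q R : ℂ → ℂ × ℂ × ℂ)
    (hP : ∀ t, P t = (F t / 2, 1, 0))
    (hQ : ∀ t, Q t =
      ((c₁ ^ 2 + t) * F t / 2 + c₁ * deriv F t + deriv (deriv F) t, c₁ ^ 2 + t, c₂))
    (hR : ∀ t, R t = ((c₁ * F t + deriv F t) / 2, c₁, 1)) :
    (∀ t : ℂ,
        deriv Q t = bianchiIIBracket (Q t) (R t) + P t ∧
        deriv R t = (1/2 : ℂ) • bianchiIIBracket (Q t) (P t) ∧
        deriv P t = bianchiIIBracket (R t) (P t))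
      ↔ (∀ t : ℂ, deriv (deriv (deriv F)) t + t * deriv F t = 0) := by
  have dF (t : ℂ) := (hF t).hasDerivAt
  have dF' (t : ℂ) := (hF' t).hasDerivAt
  have dF'' (t : ℂ) := (hF'' t).hasDerivAt
  have dP (t : ℂ) : deriv P t = (deriv F t / 2, 0, 0) := by
    rw [funext hP]
    exact (((dF t).div_const 2).prodMk
      ((hasDerivAt_const t 1).prodMk (hasDerivAt_const t 0))).deriv
  have dR (t : ℂ) : deriv R t = ((c₁ * deriv F t + deriv (deriv F) t) / 2, 0, 0) := by
    rw [funext hR]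
    exact (((((dF t).const_mul c₁).add (dF' t)).div_const 2).prodMk
      ((hasDerivAt_const t c₁).prodMk (hasDerivAt_const t 1))).deriv
  have dQ (t : ℂ) : deriv Q t =
      ((1 * F t + (c₁ ^ 2 + t) * deriv F t) / 2 + c₁ * deriv (deriv F) t
        + deriv (deriv (deriv F)) t, 1, 0) := by
    rw [funext hQ]
    have hlin : HasDerivAt (fun s : ℂ => c₁ ^ 2 + s) 1 t := (hasDerivAt_id t).const_add _
    exact (((((hlin.mul (dF t)).div_const 2).add ((dF' t).const_mul c₁)).add (dF'' t)).prodMk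
      (hlin.prodMk (hasDerivAt_const t c₂))).deriv
  refine forall_congr' fun t => ?_
  rw [dP, dQ, dR, hP, hQ, hR]
  simp only [bianchiIIBracket, Prod.mk_add_mk, Prod.smul_mk, Prod.mk.injEq, smul_eq_mul]
  constructor
  · rintro ⟨⟨h, -⟩, -⟩
    linear_combination h
  · intro h
    and_intros
    · linear_combination h
    all_goals first | trivial | ring
end

section
/- Equip ℂ³ with the bilinear bracket [(a₁,a₂,a₃),(b₁,b₂,b₃)] = (a₁b₂ − a₂b₁, 0, 0) (the Bianchi II Lie algebra). Suppose P = (p₁,p₂,p₃), Q = (q₁,q₂,q₃), R = (r₁,r₂,r₃) : ℂ → ℂ³ have infinitely differentiable components and satisfy Q' = [Q,R] + P, R' = (1/2)[Q,P], P' = [R,P] for all t ∈ ℂ. Then: (i) p₂, p₃, r₂, r₃ are constant functions; (ii) q₂(t) = p₂·t + q₂(0) and q₃'(t) = p₃ for all t; and (iii) if the constant c₀ := p₂ is nonzero, then with c₁ := r₂ and c₃ := q₂(0), the function F := 2p₁ satisfies F'''(t) + ((c₃c₀ − c₁²) + c₀²·t)·F'(t) = 0 for all t ∈ ℂ. -/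
/-- A function `ℂ → ℂ` with everywhere vanishing derivative is constant. -/
theorem eq_apply_zero_of_hasDerivAt_zero {f : ℂ → ℂ} (hf : ∀ t, HasDerivAt f 0 t) (t : ℂ) :
    f t = f 0 :=
  is_const_of_deriv_eq_zero (fun s => (hf s).differentiableAt) (fun s => (hf s).deriv) t 0

/-- The componentwise form of the derivative of a curve in `ℂ³`. -/
theorem HasDerivAt.components {X : ℂ → ℂ × ℂ × ℂ} {v : ℂ × ℂ × ℂ} {t : ℂ}
    (h : HasDerivAt X v t) :
    HasDerivAt (fun s => (X s).1) v.1 t ∧ HasDerivAt (fun s => (X s).2.1) v.2.1 t ∧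
      HasDerivAt (fun s => (X s).2.2) v.2.2 t :=
  ⟨h.fst, h.snd.fst, h.snd.snd⟩

/-- If `P = (p₁,p₂,p₃)`, `Q = (q₁,q₂,q₃)`, `R = (r₁,r₂,r₃)` are
smooth curves in the Bianchi II Lie algebra satisfying the reduced ASD system
`Q' = [Q,R] + P`, `R' = ½[Q,P]`, `P' = [R,P]`, then:
(i) `p₂, p₃, r₂, r₃` are constant;
(ii) `q₂ t = p₂ t + q₂ 0` and `q₃' t = p₃`;
(iii) if `c₀ := p₂ ≠ 0` then, with `c₁ := r₂` and `c₃ := q₂ 0`, the function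
`F := 2 p₁` satisfies `F''' t + ((c₃ c₀ - c₁²) + c₀² t) F' t = 0`. -/
theorem stmt3 (P Q R : ℂ → ℂ × ℂ × ℂ)
    (hP : ContDiff ℂ ⊤ P) (hQ : ContDiff ℂ ⊤ Q) (hR : ContDiff ℂ ⊤ R)
    (hsys : ∀ t : ℂ,
        deriv Q t = bianchiIIBracket (Q t) (R t) + P t ∧
        deriv R t = (1/2 : ℂ) • bianchiIIBracket (Q t) (P t) ∧
        deriv P t = bianchiIIBracket (R t) (P t)) :
    (∀ t : ℂ, (P t).2.1 = (P 0).2.1 ∧ (P t).2.2 = (P 0).2.2 ∧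
        (R t).2.1 = (R 0).2.1 ∧ (R t).2.2 = (R 0).2.2) ∧
    (∀ t : ℂ, (Q t).2.1 = (P 0).2.1 * t + (Q 0).2.1 ∧
        deriv (fun s => (Q s).2.2) t = (P 0).2.2) ∧
    ((P 0).2.1 ≠ 0 →
      ∀ t : ℂ,
        deriv (deriv (deriv (fun s => 2 * (P s).1))) t
          + (((Q 0).2.1 * (P 0).2.1 - (R 0).2.1 ^ 2) + (P 0).2.1 ^ 2 * t)
            * deriv (fun s => 2 * (P s).1) t = 0) := by
  have hP' : ∀ t, HasDerivAt P (bianchiIIBracket (R t) (P t)) t := fun t =>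
    (hsys t).2.2 ▸ (hP.differentiable (by simp) t).hasDerivAt
  have hQ' : ∀ t, HasDerivAt Q (bianchiIIBracket (Q t) (R t) + P t) t := fun t =>
    (hsys t).1 ▸ (hQ.differentiable (by simp) t).hasDerivAt
  have hR' : ∀ t, HasDerivAt R ((1/2 : ℂ) • bianchiIIBracket (Q t) (P t)) t := fun t =>
    (hsys t).2.1 ▸ (hR.differentiable (by simp) t).hasDerivAt
  have p2 : ∀ t, (P t).2.1 = (P 0).2.1 := eq_apply_zero_of_hasDerivAt_zero fun t => by
    simpa [bianchiIIBracket] using (hP' t).components.2.1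
  have p3 : ∀ t, (P t).2.2 = (P 0).2.2 := eq_apply_zero_of_hasDerivAt_zero fun t => by
    simpa [bianchiIIBracket] using (hP' t).components.2.2
  have r2 : ∀ t, (R t).2.1 = (R 0).2.1 := eq_apply_zero_of_hasDerivAt_zero fun t => by
    simpa [bianchiIIBracket] using (hR' t).components.2.1
  have r3 : ∀ t, (R t).2.2 = (R 0).2.2 := eq_apply_zero_of_hasDerivAt_zero fun t => by
    simpa [bianchiIIBracket] using (hR' t).components.2.2
  have dq2 : ∀ t, HasDerivAt (fun s => (Q s).2.1) (P 0).2.1 t := fun t => by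
    simpa [bianchiIIBracket, p2 t] using (hQ' t).components.2.1
  have dq3 : ∀ t, HasDerivAt (fun s => (Q s).2.2) (P 0).2.2 t := fun t => by
    simpa [bianchiIIBracket, p3 t] using (hQ' t).components.2.2
  have q2 : ∀ t, (Q t).2.1 = (P 0).2.1 * t + (Q 0).2.1 := fun t => by
    have h := eq_apply_zero_of_hasDerivAt_zero
      (f := fun s => (Q s).2.1 - (P 0).2.1 * s) (fun s => by
        simpa using (dq2 s).fun_sub ((hasDerivAt_id' s).const_mul (P 0).2.1)) t
    simp only [mul_zero, sub_zero] at h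
    linear_combination h
  refine ⟨fun t => ⟨p2 t, p3 t, r2 t, r3 t⟩, fun t => ⟨q2 t, (dq3 t).deriv⟩, fun _ t => ?_⟩
  have dp1 : ∀ t, HasDerivAt (fun s => (P s).1)
      ((R t).1 * (P 0).2.1 - (R 0).2.1 * (P t).1) t := fun t => by
    simpa [bianchiIIBracket, p2 t, r2 t] using (hP' t).components.1
  have dr1 : ∀ t, HasDerivAt (fun s => (R s).1)
      (1/2 * ((Q t).1 * (P 0).2.1 - (Q t).2.1 * (P t).1)) t := fun t => by
    simpa [bianchiIIBracket, p2 t] using (hR' t).components.1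
  have dq1 : ∀ t, HasDerivAt (fun s => (Q s).1)
      ((Q t).1 * (R 0).2.1 - (Q t).2.1 * (R t).1 + (P t).1) t := fun t => by
    simpa [bianchiIIBracket, r2 t] using (hQ' t).components.1
  have d1 := deriv_eq fun t => (dp1 t).const_mul 2
  have d2 := deriv_eq fun t =>
    (((dr1 t).mul_const (P 0).2.1).fun_sub ((dp1 t).const_mul (R 0).2.1)).const_mul 2
  have d3 := ((((((dq1 t).mul_const (P 0).2.1).fun_sub ((dq2 t).fun_mul (dp1 t))).const_mul
    (1/2)).mul_const (P 0).2.1).fun_sub ((((dr1 t).mul_const (P 0).2.1).fun_sub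
      ((dp1 t).const_mul (R 0).2.1)).const_mul (R 0).2.1)).const_mul 2 |>.deriv
  rw [d1, d2, d3, q2 t]
  ring
end

section
/- Let n ≥ 1 and let P, Q, R : ℂ → Matrix n n ℂ be differentiable. Define Θ(t,λ) = Q(t) + 2λR(t) + λ²P(t) and Θ₊(t,λ) = R(t) + λP(t). Then the zero-curvature equation (∂Θ₊/∂λ)(t,λ) − (∂Θ/∂t)(t,λ) + [Θ(t,λ), Θ₊(t,λ)] = 0 holds for all (t,λ) ∈ ℂ² if and only if the system Q'(t) = [Q(t),R(t)] + P(t), R'(t) = (1/2)[Q(t),P(t)], P'(t) = [R(t),P(t)] holds for all t ∈ ℂ, where [A,B] = AB − BA denotes the matrix commutator. -/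
/-- The matrix commutator `[A,B] = AB - BA`. -/
noncomputable def matComm {n : ℕ} (A B : Matrix (Fin n) (Fin n) ℂ) : Matrix (Fin n) (Fin n) ℂ :=
  A * B - B * A

/-- The isomonodromy matrix `Θ(t,λ) = Q t + 2λ R t + λ² P t`. -/
noncomputable def Theta {n : ℕ} (P Q R : ℂ → Matrix (Fin n) (Fin n) ℂ) (t l : ℂ) :
    Matrix (Fin n) (Fin n) ℂ :=
  Q t + (2 * l) • R t + l ^ 2 • P t

/-- The isomonodromy matrix `Θ₊(t,λ) = R t + λ P t`. -/
noncomputable def ThetaPlus {n : ℕ} (P R : ℂ → Matrix (Fin n) (Fin n) ℂ) (t l : ℂ) :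
    Matrix (Fin n) (Fin n) ℂ :=
  R t + l • P t

theorem matComm_Theta_ThetaPlus {n : ℕ} (P Q R : ℂ → Matrix (Fin n) (Fin n) ℂ) (t l : ℂ) :
    matComm (Theta P Q R t l) (ThetaPlus P R t l)
      = matComm (Q t) (R t) + l • matComm (Q t) (P t) + l ^ 2 • matComm (R t) (P t) := by
  simp only [matComm, Theta, ThetaPlus, add_mul, mul_add, smul_mul_assoc, mul_smul_comm]
  module

theorem deriv_ThetaPlus_apply {n : ℕ} (P R : ℂ → Matrix (Fin n) (Fin n) ℂ) (t l : ℂ)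
    (i j : Fin n) : deriv (fun l' => ThetaPlus P R t l' i j) l = P t i j := by
  simp [ThetaPlus]

theorem deriv_Theta_apply {n : ℕ} {P Q R : ℂ → Matrix (Fin n) (Fin n) ℂ} {t : ℂ} {i j : Fin n}
    (hP : DifferentiableAt ℂ (fun s => P s i j) t)
    (hQ : DifferentiableAt ℂ (fun s => Q s i j) t)
    (hR : DifferentiableAt ℂ (fun s => R s i j) t) (l : ℂ) :
    deriv (fun s => Theta P Q R s l i j) t
      = deriv (fun s => Q s i j) t + 2 * l * deriv (fun s => R s i j) t
        + l ^ 2 * deriv (fun s => P s i j) t :=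
  ((hQ.hasDerivAt.add (hR.hasDerivAt.const_mul (2 * l))).add
    (hP.hasDerivAt.const_mul (l ^ 2))).deriv

/-- For differentiable matrix curves `P, Q, R`, the zero-curvature
equation `∂Θ₊/∂λ - ∂Θ/∂t + [Θ, Θ₊] = 0` (entrywise, for all `(t,λ)`) holds iff
the system `Q' = [Q,R] + P`, `R' = ½[Q,P]`, `P' = [R,P]` holds for all `t`. -/
theorem stmt4 (n : ℕ) (hn : 1 ≤ n) (P Q R : ℂ → Matrix (Fin n) (Fin n) ℂ)
    (hP : ∀ i j, Differentiable ℂ (fun t => P t i j))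
    (hQ : ∀ i j, Differentiable ℂ (fun t => Q t i j))
    (hR : ∀ i j, Differentiable ℂ (fun t => R t i j)) :
    (∀ (t l : ℂ) (i j : Fin n),
        deriv (fun l' => ThetaPlus P R t l' i j) l
          - deriv (fun t' => Theta P Q R t' l i j) t
          + matComm (Theta P Q R t l) (ThetaPlus P R t l) i j = 0)
      ↔ (∀ (t : ℂ) (i j : Fin n),
          deriv (fun s => Q s i j) t = (matComm (Q t) (R t) + P t) i j ∧
          deriv (fun s => R s i j) t = ((1/2 : ℂ) • matComm (Q t) (P t)) i j ∧
          deriv (fun s => P s i j) t = matComm (R t) (P t) i j) := by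
  simp only [deriv_ThetaPlus_apply, matComm_Theta_ThetaPlus,
    fun t l i j => deriv_Theta_apply (hP i j t) (hQ i j t) (hR i j t) l,
    Matrix.add_apply, Matrix.smul_apply, smul_eq_mul]
  constructor
  · intro h t i j
    have h₀ := h t 0 i j
    have h₁ := h t 1 i j
    have h₂ := h t (-1) i j
    refine ⟨?_, ?_, ?_⟩
    · linear_combination -h₀
    · linear_combination (-1 / 4 : ℂ) * h₁ + (1 / 4 : ℂ) * h₂
    · linear_combination h₀ - (1 / 2 : ℂ) * h₁ - (1 / 2 : ℂ) * h₂
  · intro h t l i j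
    obtain ⟨h₀, h₁, h₂⟩ := h t i j
    linear_combination -h₀ - 2 * l * h₁ - l ^ 2 * h₂
end

section
/- Let n ≥ 1, let P, Q, R : ℂ → Matrix n n ℂ be differentiable, and set Θ(t,λ) = Q(t) + 2λR(t) + λ²P(t), Θ₊(t,λ) = R(t) + λP(t). Suppose Ψ : ℂ² → Matrix n n ℂ is twice continuously differentiable with commuting mixed second partial derivatives, Ψ(t,λ) is invertible for every (t,λ), and Ψ solves the overdetermined linear system ∂Ψ/∂λ + ΘΨ = 0 and ∂Ψ/∂t + Θ₊Ψ = 0 on all of ℂ². Then P, Q, R satisfy Q'(t) = [Q(t),R(t)] + P(t), R'(t) = (1/2)[Q(t),P(t)], P'(t) = [R(t),P(t)] for all t ∈ ℂ, where [A,B] = AB − BA. -/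
/-- The product rule for matrix-valued curves, entry by entry. -/
theorem hasDerivAt_matrix_mul_apply {n : ℕ} {A B : ℂ → Matrix (Fin n) (Fin n) ℂ}
    {A' B' : Matrix (Fin n) (Fin n) ℂ} {t : ℂ}
    (hA : ∀ i j, HasDerivAt (fun s => A s i j) (A' i j) t)
    (hB : ∀ i j, HasDerivAt (fun s => B s i j) (B' i j) t) (i j : Fin n) :
    HasDerivAt (fun s => (A s * B s) i j) ((A' * B t + A t * B') i j) t := by
  simp only [Matrix.add_apply, Matrix.mul_apply, ← Finset.sum_add_distrib]
  exact HasDerivAt.fun_sum fun k _ => (hA i k).mul (hB k j)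

/-- A quadratic matrix polynomial vanishing at `0`, `1` and `-1` has zero coefficients. -/
theorem quadratic_coeff_eq_zero {n : ℕ} {A B C : Matrix (Fin n) (Fin n) ℂ}
    (h : ∀ l : ℂ, A + l • B + l ^ 2 • C = 0) : A = 0 ∧ B = 0 ∧ C = 0 := by
  have entry (l : ℂ) (i j : Fin n) : A i j + l * B i j + l ^ 2 * C i j = 0 := by
    simpa using congrFun (congrFun (h l) i) j
  refine ⟨?_, ?_, ?_⟩ <;> ext i j <;> rw [Matrix.zero_apply]
  · linear_combination entry 0 i j
  · linear_combination (entry 1 i j - entry (-1) i j) / 2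
  · linear_combination (entry 1 i j + entry (-1) i j) / 2 - entry 0 i j


/-- If `Ψ(t,λ)` is a twice continuously differentiable, everywhere
invertible matrix solution (with commuting mixed second partials) of the
overdetermined linear system `∂Ψ/∂λ + ΘΨ = 0`, `∂Ψ/∂t + Θ₊Ψ = 0` on all of
`ℂ²`, then the differentiable curves `P, Q, R` satisfy
`Q' = [Q,R] + P`, `R' = ½[Q,P]`, `P' = [R,P]`. -/
theorem stmt5 (n : ℕ) (hn : 1 ≤ n) (P Q R : ℂ → Matrix (Fin n) (Fin n) ℂ)
    (hP : ∀ i j, Differentiable ℂ (fun t => P t i j))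
    (hQ : ∀ i j, Differentiable ℂ (fun t => Q t i j))
    (hR : ∀ i j, Differentiable ℂ (fun t => R t i j))
    (Ψ : ℂ → ℂ → Matrix (Fin n) (Fin n) ℂ)
    (hΨ : ∀ i j, ContDiff ℂ 2 (fun p : ℂ × ℂ => Ψ p.1 p.2 i j))
    (hmix : ∀ (t l : ℂ) (i j : Fin n),
        deriv (fun t' => deriv (fun l' => Ψ t' l' i j) l) t
          = deriv (fun l' => deriv (fun t' => Ψ t' l' i j) t) l)
    (hinv : ∀ t l : ℂ, IsUnit (Ψ t l))
    (hlin1 : ∀ (t l : ℂ) (i j : Fin n),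
        deriv (fun l' => Ψ t l' i j) l + (Theta P Q R t l * Ψ t l) i j = 0)
    (hlin2 : ∀ (t l : ℂ) (i j : Fin n),
        deriv (fun t' => Ψ t' l i j) t + (ThetaPlus P R t l * Ψ t l) i j = 0) :
    ∀ (t : ℂ) (i j : Fin n),
      deriv (fun s => Q s i j) t = (matComm (Q t) (R t) + P t) i j ∧
      deriv (fun s => R s i j) t = ((1/2 : ℂ) • matComm (Q t) (P t)) i j ∧
      deriv (fun s => P s i j) t = matComm (R t) (P t) i j := by
  intro t
  obtain ⟨P', hP'⟩ : ∃ M : Matrix (Fin n) (Fin n) ℂ, ∀ i j,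
      HasDerivAt (fun s => P s i j) (M i j) t := ⟨_, fun i j => (hP i j t).hasDerivAt⟩
  obtain ⟨Q', hQ'⟩ : ∃ M : Matrix (Fin n) (Fin n) ℂ, ∀ i j,
      HasDerivAt (fun s => Q s i j) (M i j) t := ⟨_, fun i j => (hQ i j t).hasDerivAt⟩
  obtain ⟨R', hR'⟩ : ∃ M : Matrix (Fin n) (Fin n) ℂ, ∀ i j,
      HasDerivAt (fun s => R s i j) (M i j) t := ⟨_, fun i j => (hR i j t).hasDerivAt⟩
  have hΨd (i j : Fin n) : Differentiable ℂ (fun p : ℂ × ℂ => Ψ p.1 p.2 i j) :=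
    (hΨ i j).differentiable (by norm_num)
  have hΨl (l : ℂ) (i j : Fin n) :
      HasDerivAt (fun l' => Ψ t l' i j) ((-(Theta P Q R t l * Ψ t l)) i j) l := by
    have hd : DifferentiableAt ℂ (fun l' => Ψ t l' i j) l :=
      (hΨd i j (t, l)).comp l (f := fun l' : ℂ => (t, l')) (by fun_prop)
    rw [Matrix.neg_apply, ← eq_neg_of_add_eq_zero_left (hlin1 t l i j)]
    exact hd.hasDerivAt
  have hΨt (l : ℂ) (i j : Fin n) :
      HasDerivAt (fun t' => Ψ t' l i j) ((-(ThetaPlus P R t l * Ψ t l)) i j) t := by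
    have hd : DifferentiableAt ℂ (fun t' => Ψ t' l i j) t :=
      (hΨd i j (t, l)).comp t (f := fun t' : ℂ => (t', l)) (by fun_prop)
    rw [Matrix.neg_apply, ← eq_neg_of_add_eq_zero_left (hlin2 t l i j)]
    exact hd.hasDerivAt
  have hTheta (l : ℂ) (i j : Fin n) : HasDerivAt (fun s => Theta P Q R s l i j)
      ((Q' + (2 * l) • R' + l ^ 2 • P') i j) t :=
    ((hQ' i j).add ((hR' i j).const_mul (2 * l))).add ((hP' i j).const_mul (l ^ 2))
  have hThetaPlus (l : ℂ) (i j : Fin n) :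
      HasDerivAt (fun l' => ThetaPlus P R t l' i j) (P t i j) l := by
    simpa [ThetaPlus] using ((hasDerivAt_id l).mul_const (P t i j)).const_add (R t i j)
  have zero_curvature (l : ℂ) : Q' + (2 * l) • R' + l ^ 2 • P' =
      P t + matComm (Theta P Q R t l) (ThetaPlus P R t l) := by
    apply (hinv t l).mul_right_cancel
    have hcross : (Q' + (2 * l) • R' + l ^ 2 • P') * Ψ t l
        + Theta P Q R t l * -(ThetaPlus P R t l * Ψ t l)
        = P t * Ψ t l + ThetaPlus P R t l * -(Theta P Q R t l * Ψ t l) := by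
      ext i j
      have h := hmix t l i j
      simp only [fun t l => eq_neg_of_add_eq_zero_left (hlin1 t l i j),
        fun t l => eq_neg_of_add_eq_zero_left (hlin2 t l i j)] at h
      rw [(hasDerivAt_matrix_mul_apply (hTheta l) (hΨt l) i j).fun_neg.deriv,
        (hasDerivAt_matrix_mul_apply (hThetaPlus l) (hΨl l) i j).fun_neg.deriv] at h
      exact neg_injective h
    rw [matComm, add_mul (P t), sub_mul, mul_assoc, mul_assoc]
    rw [mul_neg, mul_neg, ← sub_eq_add_neg, ← sub_eq_add_neg, sub_eq_iff_eq_add] at hcross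
    rw [hcross]
    abel
  obtain ⟨h0, h1, h2⟩ := quadratic_coeff_eq_zero
    (A := Q' - (matComm (Q t) (R t) + P t)) (B := (2 : ℂ) • R' - matComm (Q t) (P t))
    (C := P' - matComm (R t) (P t)) fun l => by
      have h := sub_eq_zero.mpr (zero_curvature l)
      rw [← h]
      simp only [matComm, Theta, ThetaPlus, add_mul, mul_add, smul_mul_assoc, mul_smul_comm]
      module
  have hR2 : R' = (1 / 2 : ℂ) • matComm (Q t) (P t) := by
    rw [← sub_eq_zero.mp h1, smul_smul]
    norm_num
  intro i j
  rw [(hQ' i j).deriv, (hR' i j).deriv, (hP' i j).deriv, ← sub_eq_zero.mp h0, ← hR2,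
    ← sub_eq_zero.mp h2]
  exact ⟨rfl, rfl, rfl⟩
end

section
/- Let a ≤ b be reals and let γ : [a,b] → ℂ be continuously differentiable. Define f : ℂ → ℂ by f(t) = ∫ₐᵇ exp(γ(s)³/3 + γ(s)·t) · γ'(s) ds. Then f is twice differentiable and for every t ∈ ℂ, f''(t) + t·f(t) = exp(γ(b)³/3 + γ(b)·t) − exp(γ(a)³/3 + γ(a)·t). In particular, if the boundary values exp(γ(a)³/3 + γ(a)·t) and exp(γ(b)³/3 + γ(b)·t) coincide for all t, then f satisfies the Airy equation f''(t) + t·f(t) = 0. -/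
open Complex

open MeasureTheory in
/-- Differentiation under the integral sign for `t ↦ ∫ s in a..b, exp (p s + γ s * t) * h s`. -/
theorem hasDerivAt_integral_exp_add_mul {a b : ℝ} {p γ h : ℝ → ℂ}
    (hp : ContinuousOn p (Set.uIcc a b)) (hγ : ContinuousOn γ (Set.uIcc a b))
    (hh : ContinuousOn h (Set.uIcc a b)) (t : ℂ) :
    HasDerivAt (fun t => ∫ s in a..b, Complex.exp (p s + γ s * t) * h s)
      (∫ s in a..b, Complex.exp (p s + γ s * t) * (γ s * h s)) t := by
  have hF {k : ℝ → ℂ} (hk : ContinuousOn k (Set.uIcc a b)) (x : ℂ) :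
      ContinuousOn (fun s => Complex.exp (p s + γ s * x) * k s) (Set.uIcc a b) := by
    fun_prop
  have hmeas {k : ℝ → ℂ} (hk : ContinuousOn k (Set.uIcc a b)) (x : ℂ) :
      AEStronglyMeasurable (fun s => Complex.exp (p s + γ s * x) * k s)
        (volume.restrict (Set.uIoc a b)) :=
    ((hF hk x).mono Set.uIoc_subset_uIcc).aestronglyMeasurable measurableSet_uIoc
  obtain ⟨C, hC⟩ : ∃ C, ∀ q ∈ Metric.closedBall t 1 ×ˢ Set.uIcc a b,
      ‖Complex.exp (p q.2 + γ q.2 * q.1) * (γ q.2 * h q.2)‖ ≤ C := by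
    apply ((isCompact_closedBall t 1).prod isCompact_uIcc).exists_bound_of_continuousOn
    have hsnd : Set.MapsTo Prod.snd (Metric.closedBall t 1 ×ˢ Set.uIcc a b) (Set.uIcc a b) :=
      fun q hq => hq.2
    have hp' := hp.comp continuousOn_snd hsnd
    have hγ' := hγ.comp continuousOn_snd hsnd
    have hh' := hh.comp continuousOn_snd hsnd
    exact (hp'.add (hγ'.mul continuousOn_fst)).cexp.mul (hγ'.mul hh')
  refine (intervalIntegral.hasDerivAt_integral_of_dominated_loc_of_deriv_le
    (F' := fun t s => Complex.exp (p s + γ s * t) * (γ s * h s)) (bound := fun _ => C)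
    (Metric.closedBall_mem_nhds t one_pos) (Filter.Eventually.of_forall (hmeas hh))
    (hF hh t).intervalIntegrable (hmeas (hγ.mul hh) t) ?_ intervalIntegrable_const ?_).2
  · exact Filter.Eventually.of_forall fun s hs x hx =>
      hC (x, s) ⟨hx, Set.uIoc_subset_uIcc hs⟩
  · refine Filter.Eventually.of_forall fun s _ x _ => ?_
    refine ((((hasDerivAt_id' x).const_mul (γ s)).const_add (p s)).cexp.mul_const
      (h s)).congr_deriv ?_
    ring

/-- Let `γ : [a,b] → ℂ` be continuously differentiable (with
derivative `γ'`) and `f t = ∫ s in a..b, exp (γ s ³ / 3 + γ s * t) * γ' s`.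
Then `f` is twice differentiable and
`f'' t + t * f t = exp (γ b ³/3 + γ b * t) - exp (γ a ³/3 + γ a * t)`
for every `t`; in particular if the boundary values coincide for all `t`,
then `f` satisfies the Airy equation `f'' t + t * f t = 0`. -/
theorem stmt6 (a b : ℝ) (hab : a ≤ b) (γ γ' : ℝ → ℂ)
    (hderiv : ∀ s ∈ Set.Icc a b, HasDerivAt γ (γ' s) s)
    (hcont : ContinuousOn γ' (Set.Icc a b))
    (f : ℂ → ℂ)
    (hf : ∀ t : ℂ, f t = ∫ s in a..b, Complex.exp ((γ s) ^ 3 / 3 + γ s * t) * γ' s) :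
    Differentiable ℂ f ∧ Differentiable ℂ (deriv f) ∧
    (∀ t : ℂ, deriv (deriv f) t + t * f t
        = Complex.exp ((γ b) ^ 3 / 3 + γ b * t) - Complex.exp ((γ a) ^ 3 / 3 + γ a * t)) ∧
    ((∀ t : ℂ, Complex.exp ((γ a) ^ 3 / 3 + γ a * t)
        = Complex.exp ((γ b) ^ 3 / 3 + γ b * t)) →
      ∀ t : ℂ, deriv (deriv f) t + t * f t = 0) := by
  have hγ : ContinuousOn γ (Set.uIcc a b) := by
    rw [Set.uIcc_of_le hab]
    exact fun s hs => (hderiv s hs).continuousAt.continuousWithinAt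
  have hγ' : ContinuousOn γ' (Set.uIcc a b) := by rwa [Set.uIcc_of_le hab]
  have hp : ContinuousOn (fun s => γ s ^ 3 / 3) (Set.uIcc a b) := by fun_prop
  have h₁ (t : ℂ) : HasDerivAt f
      (∫ s in a..b, Complex.exp (γ s ^ 3 / 3 + γ s * t) * (γ s * γ' s)) t := by
    rw [funext hf]
    exact hasDerivAt_integral_exp_add_mul hp hγ hγ' t
  have h₂ (t : ℂ) : HasDerivAt (deriv f)
      (∫ s in a..b, Complex.exp (γ s ^ 3 / 3 + γ s * t) * (γ s * (γ s * γ' s))) t := by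
    rw [funext fun t => (h₁ t).deriv]
    exact hasDerivAt_integral_exp_add_mul hp hγ (hγ.mul hγ') t
  have key (t : ℂ) : deriv (deriv f) t + t * f t
      = Complex.exp ((γ b) ^ 3 / 3 + γ b * t) - Complex.exp ((γ a) ^ 3 / 3 + γ a * t) := by
    rw [(h₂ t).deriv, hf t, ← intervalIntegral.integral_const_mul,
      ← intervalIntegral.integral_add]
    · refine intervalIntegral.integral_eq_sub_of_hasDerivAt
        (f := fun s => Complex.exp (γ s ^ 3 / 3 + γ s * t)) (fun s hs => ?_) ?_
      · have hs' := hderiv s (by rwa [Set.uIcc_of_le hab] at hs)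
        refine (((hs'.fun_pow 3).div_const 3).fun_add (hs'.mul_const t)).cexp.congr_deriv ?_
        push_cast
        ring
      · apply ContinuousOn.intervalIntegrable
        fun_prop
    all_goals
      apply ContinuousOn.intervalIntegrable
      fun_prop
  exact ⟨fun t => (h₁ t).differentiableAt, fun t => (h₂ t).differentiableAt, key,
    fun h t => by rw [key, h, sub_self]⟩
end

section
/- Define f : ℂ → ℂ by f(t) = ∫_ℝ i·exp((1 + i s)³/3 + (1 + i s)·t) ds (the contour integral of exp(λ³/3 + λt) along the vertical line Re λ = 1). Then: (i) for every t ∈ ℂ the integrand s ↦ i·exp((1 + i s)³/3 + (1 + i s)·t) is integrable over ℝ; (ii) f is twice differentiable on ℂ; and (iii) f satisfies the Airy equation f''(t) + t·f(t) = 0 for all t ∈ ℂ. -/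
open MeasureTheory

/-- The integrand of the `n`-th derivative of the Airy contour integral along `Re λ = 1`. -/
noncomputable def airyIntegrand (n : ℕ) (t : ℂ) (s : ℝ) : ℂ :=
  Complex.I * ((1 + Complex.I * s) ^ n *
    Complex.exp ((1 + Complex.I * s) ^ 3 / 3 + (1 + Complex.I * s) * t))

/-- A Gaussian that dominates `airyIntegrand n t` for all `t` with `‖t‖ ≤ R`. -/
noncomputable def airyBound (n : ℕ) (R s : ℝ) : ℝ :=
  Real.exp (1 / 3 + (n + R) ^ 2 / 2 + 1 / 2) * Real.exp (-(1 / 2) * s ^ 2)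

lemma integrable_airyBound (n : ℕ) (R : ℝ) : Integrable (airyBound n R) :=
  (integrable_exp_neg_mul_sq (by norm_num)).const_mul _

lemma norm_airyIntegrand_le (n : ℕ) {t : ℂ} {R : ℝ} (ht : ‖t‖ ≤ R) (s : ℝ) :
    ‖airyIntegrand n t s‖ ≤ airyBound n R s := by
  set z : ℂ := 1 + Complex.I * s with hz
  have hre : (z ^ 3 / 3).re = 1 / 3 - s ^ 2 := by
    have h : z ^ 3 / 3 = ((1 / 3 - s ^ 2 : ℝ) : ℂ) + ((s - s ^ 3 / 3 : ℝ) : ℂ) * Complex.I := by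
      push_cast
      linear_combination (norm := (rw [hz]; ring_nf))
        ((s : ℂ) ^ 2 + (s : ℂ) ^ 3 * Complex.I / 3) * Complex.I_sq
    rw [h, Complex.add_re, Complex.ofReal_re, Complex.re_ofReal_mul, Complex.I_re]
    ring
  have hnorm : ‖z‖ ^ 2 = 1 + s ^ 2 := by
    rw [← Complex.normSq_eq_norm_sq, Complex.normSq_apply, hz]
    simp
    ring
  have hzt : (z * t).re ≤ ‖z‖ * R :=
    (Complex.re_le_norm _).trans (by rw [norm_mul]; gcongr)
  have hpow : ‖z‖ ^ n ≤ Real.exp (n * ‖z‖) := by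
    rw [Real.exp_nat_mul]
    gcongr
    linarith [Real.add_one_le_exp ‖z‖]
  rw [airyIntegrand, airyBound, ← hz, norm_mul, norm_mul, Complex.norm_I, one_mul, norm_pow,
    Complex.norm_exp, Complex.add_re, hre, ← Real.exp_add]
  calc ‖z‖ ^ n * Real.exp (1 / 3 - s ^ 2 + (z * t).re)
      ≤ Real.exp (n * ‖z‖) * Real.exp (1 / 3 - s ^ 2 + ‖z‖ * R) := by gcongr
    _ = Real.exp (n * ‖z‖ + (1 / 3 - s ^ 2 + ‖z‖ * R)) := (Real.exp_add _ _).symm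
    _ ≤ _ := by
      apply Real.exp_le_exp.mpr
      nlinarith [sq_nonneg (n + R - ‖z‖)]

lemma continuous_airyIntegrand (n : ℕ) (t : ℂ) : Continuous (airyIntegrand n t) := by
  unfold airyIntegrand
  fun_prop

lemma integrable_airyIntegrand (n : ℕ) (t : ℂ) : Integrable (airyIntegrand n t) :=
  (integrable_airyBound n ‖t‖).mono' (continuous_airyIntegrand n t).aestronglyMeasurable
    (Filter.Eventually.of_forall (norm_airyIntegrand_le n le_rfl))

lemma hasDerivAt_airyIntegrand (n : ℕ) (t : ℂ) (s : ℝ) :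
    HasDerivAt (fun t => airyIntegrand n t s) (airyIntegrand (n + 1) t s) t := by
  unfold airyIntegrand
  have h := (((((hasDerivAt_id t).const_mul (1 + Complex.I * (s : ℂ))).const_add
    ((1 + Complex.I * (s : ℂ)) ^ 3 / 3)).cexp.const_mul
    ((1 + Complex.I * (s : ℂ)) ^ n)).const_mul Complex.I)
  refine h.congr_deriv ?_
  simp only [id]
  ring

lemma hasDerivAt_integral_airyIntegrand (n : ℕ) (t : ℂ) :
    HasDerivAt (fun t => ∫ s, airyIntegrand n t s) (∫ s, airyIntegrand (n + 1) t s) t := by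
  refine (hasDerivAt_integral_of_dominated_loc_of_deriv_le
    (bound := airyBound (n + 1) (‖t‖ + 1)) (Metric.ball_mem_nhds t one_pos)
    (Filter.Eventually.of_forall fun x => (continuous_airyIntegrand n x).aestronglyMeasurable)
    (integrable_airyIntegrand n t) (continuous_airyIntegrand (n + 1) t).aestronglyMeasurable
    (Filter.Eventually.of_forall fun s x hx => ?_) (integrable_airyBound _ _)
    (Filter.Eventually.of_forall fun s x _ => hasDerivAt_airyIntegrand n x s)).2
  have hle : ‖x‖ ≤ ‖t‖ + 1 := by
    have h1 := norm_le_norm_add_norm_sub' x t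
    rw [Metric.mem_ball, dist_eq_norm] at hx
    linarith
  exact_mod_cast norm_airyIntegrand_le (n + 1) hle s

lemma integral_airyIntegrand_two_add (t : ℂ) :
    (∫ s, airyIntegrand 2 t s) + t * ∫ s, airyIntegrand 0 t s = 0 := by
  rw [← integral_const_mul, ← integral_add (integrable_airyIntegrand 2 t)
    ((integrable_airyIntegrand 0 t).const_mul t)]
  refine integral_eq_zero_of_hasDerivAt_of_integrable
    (f := fun s => -Complex.I * airyIntegrand 0 t s) (fun s => ?_)
    ((integrable_airyIntegrand 2 t).add ((integrable_airyIntegrand 0 t).const_mul t))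
    ((integrable_airyIntegrand 0 t).const_mul _)
  have hz : HasDerivAt (fun s : ℝ => 1 + Complex.I * (s : ℂ)) Complex.I s := by
    simpa using ((Complex.ofRealCLM.hasDerivAt (x := s)).const_mul Complex.I).const_add 1
  have h := ((((hz.pow 3).div_const 3).add (hz.mul_const t)).cexp.const_mul
    Complex.I).const_mul (-Complex.I)
  simp only [airyIntegrand, pow_zero, one_mul]
  refine h.congr_deriv ?_
  simp only [Pi.add_apply, Pi.pow_apply]
  push_cast
  generalize Complex.exp _ = e
  linear_combination (-Complex.I * e * ((1 + Complex.I * (s : ℂ)) ^ 2 + t)) * Complex.I_sq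

/-- Define `f t = ∫ s : ℝ, i * exp ((1 + i s)³/3 + (1 + i s) t)`,
the contour integral of `exp (λ³/3 + λ t)` along the vertical line `Re λ = 1`.
Then the integrand is integrable over `ℝ` for each `t`, `f` is twice
differentiable, and `f` satisfies the Airy equation `f'' t + t * f t = 0`. -/
theorem stmt7 (f : ℂ → ℂ)
    (hf : ∀ t : ℂ, f t = ∫ s : ℝ,
        Complex.I * Complex.exp ((1 + Complex.I * s) ^ 3 / 3 + (1 + Complex.I * s) * t)) :
    (∀ t : ℂ, Integrable (fun s : ℝ =>
        Complex.I * Complex.exp ((1 + Complex.I * s) ^ 3 / 3 + (1 + Complex.I * s) * t))) ∧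
    Differentiable ℂ f ∧ Differentiable ℂ (deriv f) ∧
    (∀ t : ℂ, deriv (deriv f) t + t * f t = 0) := by
  have hf0 : f = fun t => ∫ s, airyIntegrand 0 t s := by
    funext t
    simp [hf t, airyIntegrand]
  have hf1 : deriv f = fun t => ∫ s, airyIntegrand 1 t s := by
    funext t
    rw [hf0]
    exact (hasDerivAt_integral_airyIntegrand 0 t).deriv
  refine ⟨fun t => ?_, ?_, ?_, fun t => ?_⟩
  · exact (integrable_airyIntegrand 0 t).congr
      (Filter.Eventually.of_forall fun s => by simp [airyIntegrand])
  · rw [hf0]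
    exact fun t => (hasDerivAt_integral_airyIntegrand 0 t).differentiableAt
  · rw [hf1]
    exact fun t => (hasDerivAt_integral_airyIntegrand 1 t).differentiableAt
  · rw [hf1, (hasDerivAt_integral_airyIntegrand 1 t).deriv, hf0]
    exact integral_airyIntegrand_two_add t
end

section
/- Let ψ : ℂ³ → ℂ be holomorphic (complex-differentiable on all of ℂ³), let a ≤ b be reals, and let γ : [a,b] → ℂ be continuously differentiable. Define φ : ℂ⁴ → ℂ by φ(w, z, w̃, z̃) = ∫ₐᵇ ψ(w + γ(s)·z̃, z + γ(s)·w̃, γ(s)) · γ'(s) ds. Then φ satisfies the complexified wave equation ∂²φ/∂z∂z̃ − ∂²φ/∂w∂w̃ = 0 at every point of ℂ⁴. -/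
open MeasureTheory Metric

/-- Cauchy's formula for the derivative of an entire function, over a circle of radius one. -/
lemma deriv_eq_integral_circleMap {f : ℂ → ℂ} (hf : Differentiable ℂ f) (x : ℂ) :
    deriv f x = ∫ θ in (0 : ℝ)..2 * Real.pi, (2 * Real.pi * Complex.I : ℂ)⁻¹ *
      (deriv (circleMap x 1) θ * ((circleMap 0 1 θ ^ 2)⁻¹ * f (circleMap x 1 θ))) := by
  have h := Complex.two_pi_I_inv_smul_circleIntegral_sub_sq_inv_smul_of_differentiable
    (c := x) (R := 1) isOpen_univ (Set.subset_univ _) hf.differentiableOn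
    (mem_ball_self one_pos)
  rw [← h, intervalIntegral.integral_const_mul, circleIntegral]
  simp [circleMap]

/-- The derivative of a jointly continuous family of entire functions is jointly continuous. -/
lemma continuous_deriv_of_continuous {X : Type*} [TopologicalSpace X] {F : X → ℂ → ℂ}
    (hF : Continuous (Function.uncurry F)) (hd : ∀ p, Differentiable ℂ (F p)) :
    Continuous fun q : X × ℂ => deriv (F q.1) q.2 := by
  have h_eq : (fun q : X × ℂ => deriv (F q.1) q.2) = fun q : X × ℂ =>
      ∫ θ in (0 : ℝ)..2 * Real.pi, (2 * Real.pi * Complex.I : ℂ)⁻¹ *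
        (deriv (circleMap q.2 1) θ *
          ((circleMap 0 1 θ ^ 2)⁻¹ * F q.1 (circleMap q.2 1 θ))) :=
    funext fun q => deriv_eq_integral_circleMap (hd q.1) q.2
  rw [h_eq]
  refine intervalIntegral.continuous_parametric_intervalIntegral_of_continuous' ?_ _ _
  have hc : Continuous fun r : (X × ℂ) × ℝ => circleMap r.1.2 1 r.2 := by
    unfold circleMap; fun_prop
  have hn : Continuous fun r : (X × ℂ) × ℝ => (circleMap 0 1 r.2 ^ 2)⁻¹ :=
    Continuous.inv₀ (by unfold circleMap; fun_prop) fun r => by simp [circleMap]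
  have hFc : Continuous fun r : (X × ℂ) × ℝ => F r.1.1 (circleMap r.1.2 1 r.2) :=
    hF.comp (continuous_fst.fst.prodMk hc)
  have hdc : Continuous fun r : (X × ℂ) × ℝ => deriv (circleMap r.1.2 1) r.2 := by
    simp only [deriv_circleMap, circleMap]; fun_prop
  exact continuous_const.mul (hdc.mul (hn.mul hFc))

/-- Differentiation under the integral sign for a jointly continuous family of entire functions. -/
lemma hasDerivAt_intervalIntegral_of_continuous {f : ℝ → ℂ → ℂ}
    (hf : Continuous (Function.uncurry f)) (hd : ∀ s, Differentiable ℂ (f s)) (a b : ℝ) (x : ℂ) :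
    HasDerivAt (fun y => ∫ s in a..b, f s y) (∫ s in a..b, deriv (f s) x) x := by
  have hD := continuous_deriv_of_continuous hf hd
  obtain ⟨C, hC⟩ := (isCompact_uIcc.prod (isCompact_closedBall x 1)).exists_bound_of_continuousOn
    (hD.continuousOn (s := Set.uIcc a b ×ˢ closedBall x 1))
  have hfy (y : ℂ) : Continuous fun s => f s y := hf.comp (continuous_id.prodMk continuous_const)
  have hDx : Continuous fun s => deriv (f s) x := hD.comp (continuous_id.prodMk continuous_const)
  refine (intervalIntegral.hasDerivAt_integral_of_dominated_loc_of_deriv_le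
    (F := fun y s => f s y) (F' := fun y s => deriv (f s) y) (bound := fun _ => C)
    (closedBall_mem_nhds x one_pos) (.of_forall fun y => (hfy y).aestronglyMeasurable)
    ((hfy x).intervalIntegrable a b) hDx.aestronglyMeasurable ?_
    intervalIntegrable_const ?_).2
  · exact .of_forall fun s hs y hy => hC (s, y) ⟨Set.uIoc_subset_uIcc hs, hy⟩
  · exact .of_forall fun s _ y _ => (hd s y).hasDerivAt

/-- For a continuous, separately holomorphic function on `ℂ × ℂ`, the partial derivative in one
variable can be differentiated in the other one under Cauchy's integral. -/
lemma hasDerivAt_deriv_of_separately {G : ℂ → ℂ → ℂ} (hG : Continuous (Function.uncurry G))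
    (h₁ : ∀ y, Differentiable ℂ fun x => G x y) (h₂ : ∀ x, Differentiable ℂ (G x)) (x y : ℂ) :
    HasDerivAt (fun y => deriv (fun x => G x y) x)
      (∫ θ in (0 : ℝ)..2 * Real.pi, (2 * Real.pi * Complex.I : ℂ)⁻¹ *
        (deriv (circleMap x 1) θ *
          ((circleMap 0 1 θ ^ 2)⁻¹ * deriv (G (circleMap x 1 θ)) y))) y := by
  have h_eq : (fun y => deriv (fun x => G x y) x) = fun y =>
      ∫ θ in (0 : ℝ)..2 * Real.pi, (2 * Real.pi * Complex.I : ℂ)⁻¹ *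
        (deriv (circleMap x 1) θ * ((circleMap 0 1 θ ^ 2)⁻¹ * G (circleMap x 1 θ) y)) :=
    funext fun y => deriv_eq_integral_circleMap (h₁ y) x
  rw [h_eq]
  have hn : Continuous fun r : ℝ × ℂ => (circleMap 0 1 r.1 ^ 2)⁻¹ :=
    Continuous.inv₀ (by unfold circleMap; fun_prop) fun r => by simp [circleMap]
  have hGc : Continuous fun r : ℝ × ℂ => G (circleMap x 1 r.1) r.2 :=
    hG.comp (((continuous_circleMap x 1).comp continuous_fst).prodMk continuous_snd)
  have hdc : Continuous fun r : ℝ × ℂ => deriv (circleMap x 1) r.1 := by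
    simp only [deriv_circleMap, circleMap]; fun_prop
  convert hasDerivAt_intervalIntegral_of_continuous
    (f := fun θ y => (2 * Real.pi * Complex.I : ℂ)⁻¹ *
      (deriv (circleMap x 1) θ * ((circleMap 0 1 θ ^ 2)⁻¹ * G (circleMap x 1 θ) y)))
    (continuous_const.mul (hdc.mul (hn.mul hGc)))
    (fun θ => (((h₂ _).const_mul _).const_mul _).const_mul _) 0 (2 * Real.pi) y using 3
  simp only [deriv_const_mul_field']

/-- Mixed partial derivatives of a continuous, separately holomorphic function commute. -/
lemma deriv_deriv_comm_of_separately {G : ℂ → ℂ → ℂ} (hG : Continuous (Function.uncurry G))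
    (h₁ : ∀ y, Differentiable ℂ fun x => G x y) (h₂ : ∀ x, Differentiable ℂ (G x)) (x y : ℂ) :
    deriv (fun y => deriv (fun x => G x y) x) y = deriv (fun x => deriv (G x) y) x := by
  have hdiff : Differentiable ℂ fun x => deriv (G x) y := fun x =>
    (hasDerivAt_deriv_of_separately (G := fun y x => G x y) (hG.comp continuous_swap)
      h₂ h₁ y x).differentiableAt
  rw [(hasDerivAt_deriv_of_separately hG h₁ h₂ x y).deriv, deriv_eq_integral_circleMap hdiff]

/-- The mixed second derivative of a contour integral of twistor type, with the derivatives taken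
under the integral sign. -/
lemma deriv_deriv_twistor_integral {g : ℝ → ℂ → ℂ → ℂ}
    (hg : Continuous fun q : ℝ × ℂ × ℂ => g q.1 q.2.1 q.2.2)
    (h₁ : ∀ s y, Differentiable ℂ fun x => g s x y) (h₂ : ∀ s x, Differentiable ℂ (g s x))
    {c k : ℝ → ℂ} (hc : Continuous c) (hk : Continuous k) (a b : ℝ) (u v x₀ y₀ : ℂ) :
    deriv (fun y => deriv (fun x => ∫ s in a..b, g s (u + c s * x) (y + c s * v) * k s) x₀) y₀ =
      ∫ s in a..b, deriv (fun y => deriv (fun x => g s x y) (u + c s * x₀)) (y₀ + c s * v) *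
        (c s * k s) := by
  have inner (y : ℂ) :
      deriv (fun x => ∫ s in a..b, g s (u + c s * x) (y + c s * v) * k s) x₀ =
        ∫ s in a..b, deriv (fun x => g s x (y + c s * v)) (u + c s * x₀) * (c s * k s) := by
    have hcont : Continuous fun q : ℝ × ℂ =>
        g q.1 (u + c q.1 * q.2) (y + c q.1 * v) * k q.1 :=
      (hg.comp (g := fun q : ℝ × ℂ × ℂ => g q.1 q.2.1 q.2.2)
        (f := fun q : ℝ × ℂ => (q.1, u + c q.1 * q.2, y + c q.1 * v)) (by fun_prop)).mul
        (by fun_prop)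
    have hder (s : ℝ) (x : ℂ) :
        HasDerivAt (fun x => g s (u + c s * x) (y + c s * v) * k s)
          (deriv (fun x => g s x (y + c s * v)) (u + c s * x) * (c s * k s)) x := by
      have haff : HasDerivAt (fun x => u + c s * x) (c s) x := by
        simpa using ((hasDerivAt_id x).const_mul (c s)).const_add u
      rw [← mul_assoc]
      exact ((h₁ s (y + c s * v) (u + c s * x)).hasDerivAt.comp x haff).mul_const (k s)
    rw [(hasDerivAt_intervalIntegral_of_continuous
      (f := fun s x => g s (u + c s * x) (y + c s * v) * k s) hcont
      (fun s x => (hder s x).differentiableAt) a b x₀).deriv]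
    simp only [(hder _ _).deriv]
  simp only [inner]
  have hpart (s : ℝ) (x y : ℂ) : DifferentiableAt ℂ (fun y => deriv (fun x => g s x y) x) y :=
    (hasDerivAt_deriv_of_separately (G := g s)
      (hg.comp (g := fun q : ℝ × ℂ × ℂ => g q.1 q.2.1 q.2.2)
        (f := fun q : ℂ × ℂ => (s, q)) (by fun_prop)) (h₁ s) (h₂ s) x y).differentiableAt
  have hder (s : ℝ) (y : ℂ) :
      HasDerivAt (fun y => deriv (fun x => g s x (y + c s * v)) (u + c s * x₀) * (c s * k s))
        (deriv (fun y => deriv (fun x => g s x y) (u + c s * x₀)) (y + c s * v) *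
          (c s * k s)) y :=
    ((hpart s (u + c s * x₀) (y + c s * v)).hasDerivAt.comp_add_const y (c s * v)).mul_const _
  have hD : Continuous fun q : (ℝ × ℂ) × ℂ => deriv (fun x => g q.1.1 x q.1.2) q.2 :=
    continuous_deriv_of_continuous (F := fun (p : ℝ × ℂ) x => g p.1 x p.2)
      (hg.comp (g := fun q : ℝ × ℂ × ℂ => g q.1 q.2.1 q.2.2)
        (f := fun q : (ℝ × ℂ) × ℂ => (q.1.1, q.2, q.1.2)) (by fun_prop))
      fun p => h₁ p.1 p.2
  have hcont : Continuous fun q : ℝ × ℂ =>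
      deriv (fun x => g q.1 x (q.2 + c q.1 * v)) (u + c q.1 * x₀) * (c q.1 * k q.1) :=
    (hD.comp (g := fun q : (ℝ × ℂ) × ℂ => deriv (fun x => g q.1.1 x q.1.2) q.2)
      (f := fun q : ℝ × ℂ => ((q.1, q.2 + c q.1 * v), u + c q.1 * x₀)) (by fun_prop)).mul
      (by fun_prop)
  rw [(hasDerivAt_intervalIntegral_of_continuous
    (f := fun s y => deriv (fun x => g s x (y + c s * v)) (u + c s * x₀) * (c s * k s)) hcont
    (fun s y => (hder s y).differentiableAt) a b y₀).deriv]
  simp only [(hder _ _).deriv]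

/-- Let `ψ : ℂ³ → ℂ` be holomorphic, `γ : [a,b] → ℂ` continuously
differentiable (with derivative `γ'`), and define
`φ (w, z, wt, zt) = ∫ s in a..b, ψ (w + γ s * zt, z + γ s * wt, γ s) * γ' s`
(where `wt = w̃`, `zt = z̃`).  Then `φ` satisfies the complexified wave
equation `∂²φ/∂z∂z̃ - ∂²φ/∂w∂w̃ = 0` at every point of `ℂ⁴`. -/
theorem stmt8 (ψ : ℂ × ℂ × ℂ → ℂ) (hψ : Differentiable ℂ ψ)
    (a b : ℝ) (hab : a ≤ b) (γ γ' : ℝ → ℂ)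
    (hderiv : ∀ s ∈ Set.Icc a b, HasDerivAt γ (γ' s) s)
    (hcont : ContinuousOn γ' (Set.Icc a b))
    (φ : ℂ → ℂ → ℂ → ℂ → ℂ)
    (hφ : ∀ w z wt zt : ℂ,
      φ w z wt zt = ∫ s in a..b, ψ (w + γ s * zt, z + γ s * wt, γ s) * γ' s) :
    ∀ w z wt zt : ℂ,
      deriv (fun z' => deriv (fun zt' => φ w z' wt zt') zt) z
        - deriv (fun w' => deriv (fun wt' => φ w' z wt' zt) wt) w = 0 := by
  intro w z wt zt
  have hγ : ContinuousOn γ (Set.Icc a b) := fun s hs => (hderiv s hs).continuousAt.continuousWithinAt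
  set c : ℝ → ℂ := Set.IccExtend hab ((Set.Icc a b).domRestrict γ) with hc_def
  set k : ℝ → ℂ := Set.IccExtend hab ((Set.Icc a b).domRestrict γ') with hk_def
  have hc : Continuous c := hγ.domRestrict.Icc_extend'
  have hk : Continuous k := hcont.domRestrict.Icc_extend'
  have hφ' (w z wt zt : ℂ) :
      φ w z wt zt = ∫ s in a..b, ψ (w + c s * zt, z + c s * wt, c s) * k s := by
    rw [hφ]
    refine intervalIntegral.integral_congr fun s hs => ?_
    rw [Set.uIcc_of_le hab] at hs
    simp only [hc_def, hk_def, Set.IccExtend_of_mem hab _ hs, Set.domRestrict_apply]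
  have hψc := hψ.continuous
  have hg : Continuous fun q : ℝ × ℂ × ℂ => ψ (q.2.1, q.2.2, c q.1) := by fun_prop
  have hg' : Continuous fun q : ℝ × ℂ × ℂ => ψ (q.2.2, q.2.1, c q.1) := by fun_prop
  have h₁ (s : ℝ) (y : ℂ) : Differentiable ℂ fun x => ψ (x, y, c s) := by fun_prop
  have h₂ (s : ℝ) (x : ℂ) : Differentiable ℂ fun y => ψ (x, y, c s) := by fun_prop
  simp only [hφ']
  rw [deriv_deriv_twistor_integral (g := fun s x y => ψ (x, y, c s)) hg h₁ h₂ hc hk,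
    deriv_deriv_twistor_integral (g := fun s x y => ψ (y, x, c s)) hg' h₂ h₁ hc hk, sub_eq_zero]
  refine intervalIntegral.integral_congr fun s _ => ?_
  rw [deriv_deriv_comm_of_separately (G := fun x y => ψ (x, y, c s)) (by fun_prop) (h₁ s) (h₂ s)]
end

section
/- Let f : ℂ → ℂ be differentiable and define φ : ℂ⁴ → ℂ by φ(w, z, w̃, z̃) = exp(w − w̃(z − z̃) − (2/3)w̃³) · f(z̃ − z − w̃²). Then at every point of ℂ⁴: (i) ∂φ/∂w = φ; (ii) ∂φ/∂z + ∂φ/∂z̃ = 0; (iii) (z − z̃)·∂φ/∂w + w̃·(∂φ/∂z̃ − ∂φ/∂z) + ∂φ/∂w̃ = 0. That is, φ satisfies X(φ) = φ, Y(φ) = 0, Z(φ) = 0 for the vector fields X = ∂_w, Y = ∂_z + ∂_z̃, Z = (z − z̃)∂_w + w̃(∂_z̃ − ∂_z) + ∂_w̃ on ℂ⁴. -/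
theorem hasDerivAt_cexp_mul_comp {f a b : ℂ → ℂ} {a' b' x : ℂ}
    (hf : DifferentiableAt ℂ f (b x)) (ha : HasDerivAt a a' x) (hb : HasDerivAt b b' x) :
    HasDerivAt (fun t => Complex.exp (a t) * f (b t))
      (Complex.exp (a x) * a' * f (b x) + Complex.exp (a x) * (deriv f (b x) * b')) x :=
  ha.cexp.fun_mul (hf.hasDerivAt.comp x hb)


/-- Let `f : ℂ → ℂ` be differentiable and
`φ (w, z, wt, zt) = exp (w - wt (z - zt) - (2/3) wt³) * f (zt - z - wt²)`
(where `wt = w̃`, `zt = z̃`).  Then at every point of `ℂ⁴`: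
(i) `∂φ/∂w = φ`;
(ii) `∂φ/∂z + ∂φ/∂z̃ = 0`;
(iii) `(z - z̃) ∂φ/∂w + w̃ (∂φ/∂z̃ - ∂φ/∂z) + ∂φ/∂w̃ = 0`,
i.e. `X φ = φ`, `Y φ = 0`, `Z φ = 0` for `X = ∂_w`, `Y = ∂_z + ∂_z̃`,
`Z = (z - z̃) ∂_w + w̃ (∂_z̃ - ∂_z) + ∂_w̃`. -/
theorem stmt9 (f : ℂ → ℂ) (hf : Differentiable ℂ f)
    (φ : ℂ → ℂ → ℂ → ℂ → ℂ)
    (hφ : ∀ w z wt zt : ℂ,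
      φ w z wt zt = Complex.exp (w - wt * (z - zt) - (2/3) * wt ^ 3) * f (zt - z - wt ^ 2)) :
    ∀ w z wt zt : ℂ,
      deriv (fun w' => φ w' z wt zt) w = φ w z wt zt ∧
      deriv (fun z' => φ w z' wt zt) z + deriv (fun zt' => φ w z wt zt') zt = 0 ∧
      (z - zt) * deriv (fun w' => φ w' z wt zt) w
        + wt * (deriv (fun zt' => φ w z wt zt') zt - deriv (fun z' => φ w z' wt zt) z)
        + deriv (fun wt' => φ w z wt' zt) wt = 0 := by
  intro w z wt zt
  have hw := hasDerivAt_cexp_mul_comp (hf _)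
    (((hasDerivAt_id' w).sub_const (wt * (z - zt))).sub_const (2 / 3 * wt ^ 3))
    (hasDerivAt_const w (zt - z - wt ^ 2))
  have hz := hasDerivAt_cexp_mul_comp (hf _)
    (((((hasDerivAt_id' z).sub_const zt).const_mul wt).const_sub w).sub_const (2 / 3 * wt ^ 3))
    (((hasDerivAt_id' z).const_sub zt).sub_const (wt ^ 2))
  have hzt := hasDerivAt_cexp_mul_comp (hf _)
    (((((hasDerivAt_id' zt).const_sub z).const_mul wt).const_sub w).sub_const (2 / 3 * wt ^ 3))
    (((hasDerivAt_id' zt).sub_const z).sub_const (wt ^ 2))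
  have hwt := hasDerivAt_cexp_mul_comp (hf _)
    ((((hasDerivAt_id' wt).mul_const (z - zt)).const_sub w).fun_sub
      ((hasDerivAt_pow 3 wt).const_mul (2 / 3)))
    ((hasDerivAt_pow 2 wt).const_sub (zt - z))
  simp only [hφ]
  rw [hw.deriv, hz.deriv, hzt.deriv, hwt.deriv]
  refine ⟨by ring, by ring, ?_⟩
  push_cast
  ring
end

section
/- On ℂ⁵ with coordinates (w, z, w̃, z̃, λ), identify vector fields with maps ℂ⁵ → ℂ⁵ and define the Lie bracket pointwise by [V,W](p) = (DW)_p(V(p)) − (DV)_p(W(p)). Consider the twistor distribution vector fields l = ∂_z̃ − λ∂_w and m = ∂_w̃ − λ∂_z, and the lifted symmetry vector fields X'' = ∂_w, Y'' = ∂_z + ∂_z̃, Z'' = (z − z̃)∂_w + w̃(∂_z̃ − ∂_z) + ∂_w̃ + ∂_λ. Then at every point p ∈ ℂ⁵, each of the brackets [X'', l](p), [X'', m](p), [Y'', l](p), [Y'', m](p), [Z'', l](p), [Z'', m](p) lies in the linear span of l(p) and m(p). -/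
/-- `ℂ⁵` with coordinates `(w, z, w̃, z̃, λ)`. -/
abbrev C5 : Type := ℂ × ℂ × ℂ × ℂ × ℂ

/-- The pointwise Lie bracket of vector fields on `ℂ⁵` viewed as maps
`ℂ⁵ → ℂ⁵`: `[V,W] p = (DW)ₚ (V p) - (DV)ₚ (W p)`. -/
noncomputable def lieBracket5 (V W : C5 → C5) (p : C5) : C5 :=
  fderiv ℂ W p (V p) - fderiv ℂ V p (W p)

/-- Bracket of two affine vector fields, in terms of their linear parts. -/
theorem lieBracket5_of_affine {V W : C5 → C5} (A B : C5 →L[ℂ] C5) (a b : C5)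
    (hV : ∀ q, V q = A q + a) (hW : ∀ q, W q = B q + b) (p : C5) :
    lieBracket5 V W p = B (V p) - A (W p) := by
  have hA : fderiv ℂ V p = A := by
    rw [funext hV]; exact (A.hasFDerivAt.add_const a).fderiv
  have hB : fderiv ℂ W p = B := by
    rw [funext hW]; exact (B.hasFDerivAt.add_const b).fderiv
  rw [lieBracket5, hA, hB]

/-- On `ℂ⁵` with coordinates `(w, z, w̃, z̃, λ)`, consider the
twistor distribution `l = ∂_z̃ - λ ∂_w`, `m = ∂_w̃ - λ ∂_z` and the lifted
symmetry fields `X'' = ∂_w`, `Y'' = ∂_z + ∂_z̃`,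
`Z'' = (z - z̃) ∂_w + w̃ (∂_z̃ - ∂_z) + ∂_w̃ + ∂_λ`.  Then at every point `p`,
each bracket `[X'', l] p`, `[X'', m] p`, `[Y'', l] p`, `[Y'', m] p`,
`[Z'', l] p`, `[Z'', m] p` lies in the span of `l p` and `m p`. -/
theorem stmt11 (l m X Y Z : C5 → C5)
    (hl : ∀ w z wt zt lam : ℂ, l (w, z, wt, zt, lam) = (-lam, 0, 0, 1, 0))
    (hm : ∀ w z wt zt lam : ℂ, m (w, z, wt, zt, lam) = (0, -lam, 1, 0, 0))
    (hX : ∀ p : C5, X p = (1, 0, 0, 0, 0))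
    (hY : ∀ p : C5, Y p = (0, 1, 0, 1, 0))
    (hZ : ∀ w z wt zt lam : ℂ, Z (w, z, wt, zt, lam) = (z - zt, -wt, 1, wt, 1)) :
    ∀ p : C5, ∀ V ∈ ({X, Y, Z} : Set (C5 → C5)), ∀ D ∈ ({l, m} : Set (C5 → C5)),
      ∃ α β : ℂ, lieBracket5 V D p = α • l p + β • m p := by
  let T : C5 →L[ℂ] C5 :=
    { toFun := fun q => (q.2.1 - q.2.2.2.1, -q.2.2.1, 0, q.2.2.1, 0)
      map_add' := fun q r => by ext <;> simp <;> ring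
      map_smul' := fun c q => by ext <;> simp <;> ring
      cont := by fun_prop }
  let S : C5 →L[ℂ] C5 :=
    { toFun := fun q => (-q.2.2.2.2, 0, 0, 0, 0)
      map_add' := fun q r => by ext <;> simp <;> ring
      map_smul' := fun c q => by ext <;> simp
      cont := by fun_prop }
  let R : C5 →L[ℂ] C5 :=
    { toFun := fun q => (0, -q.2.2.2.2, 0, 0, 0)
      map_add' := fun q r => by ext <;> simp <;> ring
      map_smul' := fun c q => by ext <;> simp
      cont := by fun_prop }
  have hT (q : C5) : T q = (q.2.1 - q.2.2.2.1, -q.2.2.1, 0, q.2.2.1, 0) := rfl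
  have hS (q : C5) : S q = (-q.2.2.2.2, 0, 0, 0, 0) := rfl
  have hR (q : C5) : R q = (0, -q.2.2.2.2, 0, 0, 0) := rfl
  have hl' (q : C5) : l q = S q + (0, 0, 0, 1, 0) := by
    obtain ⟨w, z, wt, zt, lam⟩ := q; simp [hl, hS]
  have hm' (q : C5) : m q = R q + (0, 0, 1, 0, 0) := by
    obtain ⟨w, z, wt, zt, lam⟩ := q; simp [hm, hR]
  have hX' (q : C5) : X q = (0 : C5 →L[ℂ] C5) q + (1, 0, 0, 0, 0) := by simp [hX]
  have hY' (q : C5) : Y q = (0 : C5 →L[ℂ] C5) q + (0, 1, 0, 1, 0) := by simp [hY]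
  have hZ' (q : C5) : Z q = T q + (0, 0, 1, 0, 1) := by
    obtain ⟨w, z, wt, zt, lam⟩ := q; simp [hZ, hT]
  rintro ⟨w, z, wt, zt, lam⟩ V (rfl | rfl | rfl) D (rfl | rfl)
  · exact ⟨0, 0, by rw [lieBracket5_of_affine _ _ _ _ hX' hl']; simp [hX, hS]⟩
  · exact ⟨0, 0, by rw [lieBracket5_of_affine _ _ _ _ hX' hm']; simp [hX, hR]⟩
  · exact ⟨0, 0, by rw [lieBracket5_of_affine _ _ _ _ hY' hl']; simp [hY, hS]⟩
  · exact ⟨0, 0, by rw [lieBracket5_of_affine _ _ _ _ hY' hm']; simp [hY, hR]⟩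
  · exact ⟨0, 0, by rw [lieBracket5_of_affine _ _ _ _ hZ' hl']; simp [hZ, hl, hS, hT]⟩
  · exact ⟨-1, 0, by rw [lieBracket5_of_affine _ _ _ _ hZ' hm']; simp [hZ, hm, hl, hR, hT]⟩
end

section
/- Let ψ : ℂ³ → ℂ be holomorphic (complex-differentiable on all of ℂ³) in the variables (μ, ν, λ) and suppose ψ satisfies the three first-order PDEs everywhere on ℂ³: (i) ∂ψ/∂μ = ψ; (ii) ∂ψ/∂ν + λ·∂ψ/∂μ = 0; (iii) ν·∂ψ/∂μ + λ·∂ψ/∂ν + ∂ψ/∂λ = 0. Then there exists a constant c ∈ ℂ such that ψ(μ, ν, λ) = c · exp(μ − λν + λ³/3) for all (μ, ν, λ) ∈ ℂ³. -/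
/-- A solution of the linear equation `f' = g' f` on `ℂ` is a constant multiple of `exp g`. -/
theorem eq_mul_exp_sub_of_deriv_eq_mul {f g g' : ℂ → ℂ} (hf : Differentiable ℂ f)
    (hg : ∀ z, HasDerivAt g (g' z) z) (h : ∀ z, deriv f z = g' z * f z) (x y : ℂ) :
    f x = f y * Complex.exp (g x - g y) := by
  have hd : ∀ z, HasDerivAt (fun z => f z * Complex.exp (-g z)) 0 z := fun z => by
    have hfz := (hf z).hasDerivAt
    rw [h z] at hfz
    exact (hfz.mul (hg z).neg.cexp).congr_deriv (by ring)
  have hxy : f x * Complex.exp (-g x) = f y * Complex.exp (-g y) :=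
    is_const_of_deriv_eq_zero (fun z => (hd z).differentiableAt) (fun z => (hd z).deriv) x y
  rw [sub_eq_add_neg, add_comm, Complex.exp_add, ← mul_assoc, ← hxy, mul_assoc, ← Complex.exp_add]
  simp


/-- Let `ψ : ℂ³ → ℂ` be holomorphic in `(μ, ν, λ)` and satisfy
(i) `∂ψ/∂μ = ψ`, (ii) `∂ψ/∂ν + λ ∂ψ/∂μ = 0`,
(iii) `ν ∂ψ/∂μ + λ ∂ψ/∂ν + ∂ψ/∂λ = 0` everywhere on `ℂ³`.  Then there is a
constant `c : ℂ` with `ψ (μ, ν, λ) = c * exp (μ - λ ν + λ³/3)` for all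
`(μ, ν, λ)`. -/
theorem stmt13 (ψ : ℂ × ℂ × ℂ → ℂ) (hψ : Differentiable ℂ ψ)
    (h1 : ∀ μ ν lam : ℂ,
      deriv (fun μ' => ψ (μ', ν, lam)) μ = ψ (μ, ν, lam))
    (h2 : ∀ μ ν lam : ℂ,
      deriv (fun ν' => ψ (μ, ν', lam)) ν + lam * deriv (fun μ' => ψ (μ', ν, lam)) μ = 0)
    (h3 : ∀ μ ν lam : ℂ,
      ν * deriv (fun μ' => ψ (μ', ν, lam)) μ + lam * deriv (fun ν' => ψ (μ, ν', lam)) ν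
        + deriv (fun lam' => ψ (μ, ν, lam')) lam = 0) :
    ∃ c : ℂ, ∀ μ ν lam : ℂ,
      ψ (μ, ν, lam) = c * Complex.exp (μ - lam * ν + lam ^ 3 / 3) := by
  have hμ (μ ν lam : ℂ) : ψ (μ, ν, lam) = ψ (0, ν, lam) * Complex.exp μ := by
    simpa using eq_mul_exp_sub_of_deriv_eq_mul (f := fun z => ψ (z, ν, lam)) (by fun_prop)
      hasDerivAt_id (fun z => by simp [h1]) μ 0
  have hν (ν lam : ℂ) : ψ (0, ν, lam) = ψ (0, 0, lam) * Complex.exp (-(lam * ν)) := by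
    simpa using eq_mul_exp_sub_of_deriv_eq_mul (f := fun z => ψ (0, z, lam))
      (g := fun z => -lam * z) (g' := fun _ => -lam) (by fun_prop)
      (fun z => by simpa using (hasDerivAt_id z).const_mul (-lam))
      (fun z => by linear_combination h2 0 z lam - lam * h1 0 z lam) ν 0
  have hlam (lam : ℂ) : ψ (0, 0, lam) = ψ (0, 0, 0) * Complex.exp (lam ^ 3 / 3) := by
    simpa using eq_mul_exp_sub_of_deriv_eq_mul (f := fun z => ψ (0, 0, z))
      (g := fun z => z ^ 3 / 3) (g' := fun z => z ^ 2) (by fun_prop)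
      (fun z => ((hasDerivAt_pow 3 z).div_const 3).congr_deriv (by simp))
      (fun z => by
        linear_combination h3 0 0 z - z * h2 0 0 z + z ^ 2 * h1 0 0 z) lam 0
  refine ⟨ψ (0, 0, 0), fun μ ν lam => ?_⟩
  rw [hμ, hν, hlam, mul_assoc, mul_assoc, ← Complex.exp_add, ← Complex.exp_add]
  ring_nf
end
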